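/- arXiv:2003.13105 — 9 statements merged into one kernel-verified Lean document; each statement's English description precedes it below -/
import Mathlib

section
/- The function $a(t) = e^{2t}\,\big(\cosh(t)\,\log\big(\tfrac{\cosh(t)+1}{\cosh(t)-1}\big) - 2\big)$ is monotonically decreasing on $(0,\infty)$ and satisfies $\lim_{t\to\infty} a(t) = 8/3$. -/
/-- The function `a(t) = e^{2t} (cosh t * log((cosh t + 1)/(cosh t - 1)) - 2)`. -/
noncomputable def aFun (t : ℝ) : ℝ :=
  Real.exp (2 * t) * (Real.cosh t * Real.log ((Real.cosh t + 1) / (Real.cosh t - 1)) - 2)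

/-- The power series expansion of `a` in the variable `e^{-2t}`. -/
theorem hasSum_aFun {t : ℝ} (ht : 0 < t) :
    HasSum (fun k : ℕ => (2 / (2 * (k : ℝ) + 1) + 2 / (2 * (k : ℝ) + 3)) * Real.exp (-2 * t) ^ k)
      (aFun t) := by
  obtain ⟨q, hq⟩ : ∃ q, q = Real.exp (-t) := ⟨_, rfl⟩
  have hq0 : 0 < q := hq ▸ Real.exp_pos _
  have hq1 : q < 1 := by rw [hq, Real.exp_lt_one_iff]; linarith
  have hq2 : Real.exp (-2 * t) = q ^ 2 := by
    rw [hq, ← Real.exp_nat_mul]; congr 1; push_cast; ring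
  have hexp : Real.exp (2 * t) = (q ^ 2)⁻¹ := by
    rw [← hq2, ← Real.exp_neg]; congr 1; ring
  have hcosh : Real.cosh t = (q + q⁻¹) / 2 := by
    rw [Real.cosh_eq, hq, Real.exp_neg, inv_inv, add_comm]
  have hlog : Real.log ((Real.cosh t + 1) / (Real.cosh t - 1)) =
      2 * (Real.log (1 + q) - Real.log (1 - q)) := by
    have h1 : 1 - q ≠ 0 := by linarith
    have hsq : (Real.cosh t + 1) / (Real.cosh t - 1) = ((1 + q) / (1 - q)) ^ 2 := by
      have h2 : Real.cosh t + 1 = (1 + q) ^ 2 / (2 * q) := by rw [hcosh]; field_simp; ring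
      have h3 : Real.cosh t - 1 = (1 - q) ^ 2 / (2 * q) := by rw [hcosh]; field_simp; ring
      rw [h2, h3]; field_simp
    rw [hsq, Real.log_pow, Real.log_div (by linarith) h1]; norm_num
  have hL := (Real.hasSum_log_sub_log_of_abs_lt_one (abs_lt.2 ⟨by linarith, hq1⟩)).mul_right q⁻¹
  have hS := ((hasSum_nat_add_iff' 1).2 hL).mul_right (q ^ 2)⁻¹
  convert hL.add hS using 1
  · rfl
  · funext k
    rw [hq2]
    push_cast
    field_simp
    ring
  · rw [aFun, hexp, hlog, hcosh]
    simp only [Finset.sum_range_one]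
    norm_num
    field_simp
    ring

/-- `a` is monotonically decreasing on `(0, ∞)` and `a(t) → 8/3` as `t → ∞`. -/
theorem stmt1 :
    StrictAntiOn aFun (Set.Ioi (0 : ℝ)) ∧
      Filter.Tendsto aFun Filter.atTop (nhds (8 / 3)) := by
  constructor
  · intro s hs t ht hst
    have hlt : Real.exp (-2 * t) < Real.exp (-2 * s) := Real.exp_lt_exp.2 (by linarith)
    refine hasSum_lt (i := 1) (fun k => ?_) ?_ (hasSum_aFun ht) (hasSum_aFun hs)
    · dsimp only
      gcongr
    · norm_num
      linarith
  · have hexp : Filter.Tendsto (fun t : ℝ => Real.exp (-2 * t)) Filter.atTop (nhds 0) :=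
      Real.tendsto_exp_atBot.comp (Filter.tendsto_id.const_mul_atTop_of_neg (by norm_num))
    have hbound : Filter.Tendsto (fun t : ℝ => 8 / 3 * (1 - Real.exp (-2 * t))⁻¹)
        Filter.atTop (nhds (8 / 3)) := by
      simpa using ((hexp.const_sub 1).inv₀ (by norm_num)).const_mul (8 / 3)
    refine tendsto_of_tendsto_of_tendsto_of_le_of_le' tendsto_const_nhds hbound ?_ ?_ <;>
      filter_upwards [Filter.eventually_gt_atTop 0] with t ht
    · have h := le_hasSum (hasSum_aFun ht) 0 fun k _ => by positivity
      norm_num at h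
      exact h
    · refine hasSum_le (fun k => ?_) (hasSum_aFun ht) ((hasSum_geometric_of_lt_one
        (Real.exp_pos _).le (Real.exp_lt_one_iff.2 (by linarith))).mul_left (8 / 3))
      have hk : (0 : ℝ) ≤ k := k.cast_nonneg
      have h1 : 2 / (2 * (k : ℝ) + 1) ≤ 2 := div_le_self (by norm_num) (by linarith)
      have h3 : 2 / (2 * (k : ℝ) + 3) ≤ 2 / 3 := by gcongr; linarith
      gcongr
      linarith
end

section
/- For every $t > 0$, the function $a(t) = e^{2t}\,\big(\cosh(t)\,\log\big(\tfrac{\cosh(t)+1}{\cosh(t)-1}\big) - 2\big)$ satisfies $a(t) \le \tfrac{8}{3} - 2\log(1 - e^{-2t})$. -/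
theorem one_add_sq_mul_log_sub_log_le {x : ℝ} (h0 : 0 < x) (h1 : x < 1) :
    (1 + x ^ 2) * (Real.log (1 + x) - Real.log (1 - x)) - 2 * x ≤
      x ^ 3 * (8 / 3 - 2 * Real.log (1 - x ^ 2)) := by
  have hL := Real.hasSum_log_sub_log_of_abs_lt_one (abs_lt.2 ⟨by linarith, h1⟩)
  have hR := (Real.hasSum_pow_div_log_of_abs_lt_one (x := x ^ 2)
    (abs_lt.2 ⟨by nlinarith, by nlinarith⟩)).mul_left (2 * x ^ 3)
  have hS := (hL.mul_left (x ^ 2)).add ((hasSum_nat_add_iff' 1).2 hL)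
  have hT := (hasSum_nat_add_iff' 1).2 hS
  have key := hasSum_le (fun k => ?_) hT hR
  · norm_num at key
    linarith
  · have hk : (0 : ℝ) ≤ k := k.cast_nonneg
    have hp : 0 ≤ 2 * x ^ (2 * k + 5) := by positivity
    have hc : 1 / (2 * (k + 1 : ℝ) + 1) + 1 / (2 * (k + 2 : ℝ) + 1) ≤ 1 / (k + 1) := by
      rw [div_add_div _ _ (by positivity) (by positivity),
        div_le_div_iff₀ (by positivity) (by positivity)]
      nlinarith
    have h := mul_le_mul_of_nonneg_left hc hp
    push_cast
    rw [show (k : ℝ) + 1 + 1 = k + 2 by ring]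
    refine le_of_eq_of_le ?_ (h.trans_eq ?_)
    · ring
    · ring

theorem log_cosh_add_one_div_cosh_sub_one {t : ℝ} (ht : 0 < t) :
    Real.log ((Real.cosh t + 1) / (Real.cosh t - 1)) =
      2 * (Real.log (1 + Real.exp (-t)) - Real.log (1 - Real.exp (-t))) := by
  have h0 := Real.exp_pos (-t)
  have h1 : Real.exp (-t) < 1 := Real.exp_lt_one_iff.2 (by linarith)
  have hsub : 0 < 1 - Real.exp (-t) := by linarith
  have hc : Real.cosh t = ((Real.exp (-t))⁻¹ + Real.exp (-t)) / 2 := by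
    rw [Real.cosh_eq, Real.exp_neg, inv_inv]
  rw [← Real.log_div (by positivity) hsub.ne', hc]
  generalize Real.exp (-t) = x at *
  have hq : ((x⁻¹ + x) / 2 + 1) / ((x⁻¹ + x) / 2 - 1) = ((1 + x) / (1 - x)) ^ 2 := by
    have e1 : (x⁻¹ + x) / 2 + 1 = (1 + x) ^ 2 / (2 * x) := by field_simp; ring
    have e2 : (x⁻¹ + x) / 2 - 1 = (1 - x) ^ 2 / (2 * x) := by field_simp; ring
    rw [e1, e2, div_div_div_cancel_right₀ (by positivity), div_pow]
  rw [hq, Real.log_pow]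
  norm_num

/-- for every `t > 0`, `a(t) ≤ 8/3 - 2 log(1 - e^{-2t})`. -/
theorem stmt2 (t : ℝ) (ht : 0 < t) :
    aFun t ≤ 8 / 3 - 2 * Real.log (1 - Real.exp (-2 * t)) := by
  have h0 := Real.exp_pos (-t)
  have h1 : Real.exp (-t) < 1 := Real.exp_lt_one_iff.2 (by linarith)
  have hsq : Real.exp (-2 * t) = Real.exp (-t) ^ 2 := by
    rw [← Real.exp_nat_mul]; congr 1; push_cast; ring
  have hinv : Real.exp (2 * t) = (Real.exp (-t) ^ 2)⁻¹ := by
    rw [← hsq, ← Real.exp_neg]; congr 1; ring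
  have hc : Real.cosh t = ((Real.exp (-t))⁻¹ + Real.exp (-t)) / 2 := by
    rw [Real.cosh_eq, Real.exp_neg, inv_inv]
  have key := one_add_sq_mul_log_sub_log_le h0 h1
  rw [aFun, log_cosh_add_one_div_cosh_sub_one ht, hc, hsq, hinv]
  generalize Real.exp (-t) = x at *
  refine le_of_mul_le_mul_left (le_of_eq_of_le ?_ key) (pow_pos h0 3)
  field_simp
end

section
/- Let $a_n = \frac{8(n+1)}{(2n+1)(2n+3)}$ for integers $n \ge 0$. Then for every real $q$ with $0 \le q < 1$, $\Big(\sum_{n=0}^{\infty} a_n q^{2n}\Big)\Big(1 + \tfrac{q^2}{3}\Big)\big(1 - q^2\big) \;\le\; \frac{8}{3}.$ -/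
theorem tsum_mul_pow_mul_le_of_antitone {a : ℕ → ℝ} (ha : Antitone a) (ha_nonneg : ∀ n, 0 ≤ a n)
    (h_ratio : a 1 ≤ 2 / 3 * a 0) {x : ℝ} (hx0 : 0 ≤ x) (hx1 : x < 1) :
    (∑' n, a n * x ^ n) * (1 + x / 3) * (1 - x) ≤ a 0 := by
  have hs : Summable fun n => a n * x ^ n :=
    ((summable_geometric_of_lt_one hx0 hx1).mul_left (a 0)).of_nonneg_of_le
      (fun n => mul_nonneg (ha_nonneg n) (pow_nonneg hx0 n))
      (fun n => mul_le_mul_of_nonneg_right (ha n.zero_le) (pow_nonneg hx0 n))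
  have hs1 := (summable_nat_add_iff 1).2 hs
  have hs2 := (summable_nat_add_iff 2).2 hs
  have h0 := hs.tsum_eq_zero_add
  have h1 := hs1.tsum_eq_zero_add
  have hle : ∑' n, a (n + 2) * x ^ (n + 2) ≤
      ∑' n, (2 / 3 * x * (a (n + 1) * x ^ (n + 1)) + 1 / 3 * x ^ 2 * (a n * x ^ n)) := by
    refine hs2.tsum_le_tsum (fun n => ?_) ((hs1.mul_left _).add (hs.mul_left _))
    have h : a (n + 2) ≤ 2 / 3 * a (n + 1) + 1 / 3 * a n := by
      linarith [ha (by omega : n + 1 ≤ n + 2), ha (by omega : n ≤ n + 1)]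
    calc a (n + 2) * x ^ (n + 2)
        ≤ (2 / 3 * a (n + 1) + 1 / 3 * a n) * x ^ (n + 2) := by gcongr
      _ = _ := by ring
  rw [(hs1.mul_left _).tsum_add (hs.mul_left _), tsum_mul_left, tsum_mul_left] at hle
  simp only [pow_zero, mul_one, zero_add, pow_one, add_assoc, Nat.reduceAdd] at h0 h1
  rw [h1] at h0 hle
  have hx := mul_le_mul_of_nonneg_right h_ratio hx0
  set T := ∑' n, a (n + 2) * x ^ (n + 2)
  rw [h0] at hle ⊢
  linarith

theorem antitone_eight_mul_add_one_div :
    Antitone fun n : ℕ => 8 * ((n : ℝ) + 1) / ((2 * (n : ℝ) + 1) * (2 * (n : ℝ) + 3)) := by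
  refine antitone_nat_of_succ_le fun n => ?_
  push_cast
  rw [div_le_div_iff₀ (by positivity) (by positivity)]
  have hn : (0 : ℝ) ≤ n := n.cast_nonneg
  nlinarith [mul_nonneg hn hn, mul_nonneg (mul_nonneg hn hn) hn]

/-- with `a n = 8(n+1)/((2n+1)(2n+3))`, for every real `0 ≤ q < 1`,
`(∑_{n=0}^∞ a n q^(2n)) * (1 + q²/3) * (1 - q²) ≤ 8/3`. -/
theorem stmt3 (q : ℝ) (hq0 : 0 ≤ q) (hq1 : q < 1) :
    (∑' n : ℕ, 8 * ((n : ℝ) + 1) / ((2 * (n : ℝ) + 1) * (2 * (n : ℝ) + 3)) * q ^ (2 * n)) *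
        (1 + q ^ 2 / 3) * (1 - q ^ 2) ≤ 8 / 3 := by
  have h := tsum_mul_pow_mul_le_of_antitone antitone_eight_mul_add_one_div (fun n => by positivity)
    (by norm_num) (sq_nonneg q) (by nlinarith : q ^ 2 < 1)
  simp only [← pow_mul] at h
  exact h.trans (by norm_num)
end

section
/- Let $0 < z \le w$ be real numbers and set $r = \operatorname{arcsinh}\big(1/\sinh(z/2)\big)$ and $s = \operatorname{arcsinh}\big(1/\sinh(w/2)\big)$. Define $a(t) = e^{2t}\big(\cosh(t)\log\big(\tfrac{\cosh(t)+1}{\cosh(t)-1}\big) - 2\big)$, $u(z) = \frac{2\cosh(z/2)+1}{3(\cosh(z/2)+1)^2}$, and $v(w) = \frac{1}{\arctan\big(1/\sinh(w/2)\big)\cosh^2(w/2) + \sinh(w/2)}$. Then $a(r+s)\,u(z)\,v(w) \le \frac{4}{3\pi}$; equivalently, $a(r+s)\,u(z)\,v(w)\,\sinh(z/2)\sinh^2(w/2) \le \frac{4}{3\pi}\sinh(z/2)\sinh^2(w/2)$. -/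
/-- The factor `u(z) = (2 cosh(z/2) + 1)/(3 (cosh(z/2) + 1)²)`. -/
noncomputable def uFun (z : ℝ) : ℝ :=
  (2 * Real.cosh (z / 2) + 1) / (3 * (Real.cosh (z / 2) + 1) ^ 2)

/-- The factor `v(w) = (arctan(1/sinh(w/2)) cosh²(w/2) + sinh(w/2))⁻¹`. -/
noncomputable def vFun (w : ℝ) : ℝ :=
  1 / (Real.arctan (1 / Real.sinh (w / 2)) * Real.cosh (w / 2) ^ 2 + Real.sinh (w / 2))

/-- A rational upper bound for `log ((1 + m) / (1 - m)) = 2 artanh m` on `[0, 1)`. -/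
theorem log_one_add_sub_log_one_sub_le {m : ℝ} (h0 : 0 ≤ m) (h1 : m < 1) :
    Real.log (1 + m) - Real.log (1 - m) ≤
      2 * m * (3 - m ^ 2) / ((3 + m ^ 2) * (1 - m ^ 2)) := by
  let f : ℝ → ℝ := fun x => 2 * x * (3 - x ^ 2) / ((3 + x ^ 2) * (1 - x ^ 2)) -
    (Real.log (1 + x) - Real.log (1 - x))
  have hderiv : ∀ x ∈ Set.Ico (0 : ℝ) 1,
      HasDerivAt f (32 * x ^ 4 / ((3 + x ^ 2) * (1 - x ^ 2)) ^ 2) x := by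
    rintro x ⟨hx0, hx1⟩
    have hp : (1 : ℝ) + x ≠ 0 := by positivity
    have hm : (1 : ℝ) - x ≠ 0 := by linarith
    have hsq : (1 : ℝ) - x ^ 2 ≠ 0 := by
      rw [show (1 : ℝ) - x ^ 2 = (1 + x) * (1 - x) by ring]
      exact mul_ne_zero hp hm
    have h3 : (3 : ℝ) + x ^ 2 ≠ 0 := by positivity
    have hx := hasDerivAt_id' x
    have hN := (hx.const_mul 2).mul ((hx.pow 2).const_sub 3)
    have hD := ((hx.pow 2).const_add 3).mul ((hx.pow 2).const_sub 1)
    have hL := ((hx.const_add 1).log hp).sub ((hx.const_sub 1).log hm)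
    refine ((hN.div hD (mul_ne_zero h3 hsq)).sub hL).congr_deriv ?_
    have hinv : 1 / (1 + x) - -1 / (1 - x) = 2 / (1 - x ^ 2) := by
      field_simp
      ring
    rw [hinv]
    simp only [Pi.mul_apply, Pi.pow_apply]
    field_simp
    ring
  have hmono : MonotoneOn f (Set.Ico 0 1) := by
    refine monotoneOn_of_deriv_nonneg (convex_Ico 0 1)
      (fun x hx => (hderiv x hx).continuousAt.continuousWithinAt)
      (fun x hx => (hderiv x (interior_subset hx)).differentiableAt.differentiableWithinAt)
      fun x hx => ?_
    rw [(hderiv x (interior_subset hx)).deriv]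
    positivity
  have h := hmono (Set.left_mem_Ico.2 one_pos) ⟨h0, h1⟩ h0
  simp only [f] at h
  norm_num at h
  linarith

theorem aFun_eq {t : ℝ} (ht : 0 < t) :
    aFun t = (Real.exp (-t) ^ 2)⁻¹ * ((1 + Real.exp (-t) ^ 2) / Real.exp (-t) *
      (Real.log (1 + Real.exp (-t)) - Real.log (1 - Real.exp (-t))) - 2) := by
  have hm0 : 0 < Real.exp (-t) := Real.exp_pos _
  have hm1 : Real.exp (-t) < 1 := Real.exp_lt_one_iff.2 (by linarith)
  have he : Real.exp t = (Real.exp (-t))⁻¹ := by rw [Real.exp_neg, inv_inv]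
  have he2 : Real.exp (2 * t) = (Real.exp (-t) ^ 2)⁻¹ := by
    rw [two_mul, Real.exp_add, he]
    ring
  unfold aFun
  rw [Real.cosh_eq, he2, he]
  generalize Real.exp (-t) = m at *
  have hm : 1 - m ≠ 0 := by linarith
  have hq : ((m⁻¹ + m) / 2 + 1) / ((m⁻¹ + m) / 2 - 1) = ((1 + m) / (1 - m)) ^ 2 := by
    have h1 : (m⁻¹ + m) / 2 + 1 = (1 + m) ^ 2 / (2 * m) := by field_simp; ring
    have h2 : (m⁻¹ + m) / 2 - 1 = (1 - m) ^ 2 / (2 * m) := by field_simp; ring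
    rw [h1, h2]
    field_simp
  rw [hq, Real.log_pow, Real.log_div (by positivity) hm]
  push_cast
  field_simp

theorem aFun_mul_le {t : ℝ} (ht : 0 < t) :
    aFun t * ((3 + Real.exp (-t) ^ 2) * (1 - Real.exp (-t) ^ 2)) ≤ 8 := by
  have hm0 : 0 < Real.exp (-t) := Real.exp_pos _
  have hm1 : Real.exp (-t) < 1 := Real.exp_lt_one_iff.2 (by linarith)
  rw [aFun_eq ht]
  generalize Real.exp (-t) = m at *
  have hL := log_one_add_sub_log_one_sub_le hm0.le hm1
  have hsq : 0 < 1 - m ^ 2 := by nlinarith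
  calc _ ≤ (m ^ 2)⁻¹ * ((1 + m ^ 2) / m *
        (2 * m * (3 - m ^ 2) / ((3 + m ^ 2) * (1 - m ^ 2))) - 2) *
          ((3 + m ^ 2) * (1 - m ^ 2)) := by gcongr
    _ = 8 := by
      field_simp
      ring

theorem uFun_eq {z : ℝ} (hz : 0 < z) :
    uFun z = (3 + Real.exp (-Real.arsinh (1 / Real.sinh (z / 2))) ^ 2) *
      (1 - Real.exp (-Real.arsinh (1 / Real.sinh (z / 2))) ^ 2) / 12 := by
  have hS : 0 < Real.sinh (z / 2) := Real.sinh_pos_iff.2 (by linarith)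
  have hC : 0 < Real.cosh (z / 2) := Real.cosh_pos _
  have hCS := Real.cosh_sq (z / 2)
  unfold uFun
  rw [Real.exp_neg, Real.exp_arsinh]
  generalize Real.sinh (z / 2) = S at *
  generalize Real.cosh (z / 2) = C at *
  have hsqrt : √(1 + (1 / S) ^ 2) = C / S := by
    rw [Real.sqrt_eq_iff_mul_self_eq (by positivity) (by positivity), ← sq, div_pow, div_pow, hCS]
    field_simp
  have hp : (1 / S + C / S)⁻¹ ^ 2 = (C - 1) / (C + 1) := by
    have hS2 : S ^ 2 = (C - 1) * (C + 1) := by linarith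
    rw [← add_div, inv_div, div_pow, hS2]
    field_simp
    ring
  rw [hsqrt, hp]
  field_simp
  ring

theorem uFun_pos (z : ℝ) : 0 < uFun z := by
  have := Real.cosh_pos (z / 2)
  unfold uFun
  positivity

theorem vFun_nonneg {w : ℝ} (hw : 0 < w) : 0 ≤ vFun w := by
  have hS : 0 < Real.sinh (w / 2) := Real.sinh_pos_iff.2 (by linarith)
  have := Real.arctan_pos.2 (one_div_pos.2 hS)
  unfold vFun
  positivity

theorem vFun_le {w : ℝ} (hw : 0 < w) : vFun w ≤ 2 / Real.pi := by
  have hS : 0 < Real.sinh (w / 2) := Real.sinh_pos_iff.2 (by linarith)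
  have ha := Real.arctan_pos.2 (one_div_pos.2 hS)
  have harc : Real.arctan (1 / Real.sinh (w / 2)) =
      Real.pi / 2 - Real.arctan (Real.sinh (w / 2)) := by
    rw [one_div, Real.arctan_inv_of_pos hS]
  have hle : Real.arctan (Real.sinh (w / 2)) ≤ Real.sinh (w / 2) := by
    simpa only [Real.tan_arctan] using
      Real.le_tan (Real.arctan_nonneg.2 hS.le) (Real.arctan_lt_pi_div_two _)
  have hV : Real.pi / 2 ≤ Real.arctan (1 / Real.sinh (w / 2)) * Real.cosh (w / 2) ^ 2 +
      Real.sinh (w / 2) := by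
    rw [Real.cosh_sq]
    nlinarith [mul_nonneg ha.le (sq_nonneg (Real.sinh (w / 2)))]
  calc vFun w ≤ 1 / (Real.pi / 2) := one_div_le_one_div_of_le (by positivity) hV
    _ = 2 / Real.pi := one_div_div _ _

theorem aFun_mul_uFun_le {z s : ℝ} (hz : 0 < z) (hs : 0 ≤ s) :
    aFun (Real.arsinh (1 / Real.sinh (z / 2)) + s) * uFun z ≤ 2 / 3 := by
  have hr : 0 < Real.arsinh (1 / Real.sinh (z / 2)) :=
    Real.arsinh_pos_iff.2 (one_div_pos.2 (Real.sinh_pos_iff.2 (by linarith)))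
  rcases le_total (aFun (Real.arsinh (1 / Real.sinh (z / 2)) + s)) 0 with ha | ha
  · exact (mul_nonpos_of_nonpos_of_nonneg ha (uFun_pos z).le).trans (by norm_num)
  rw [uFun_eq hz]
  generalize Real.arsinh (1 / Real.sinh (z / 2)) = r at *
  have h := aFun_mul_le (add_pos_of_pos_of_nonneg hr hs)
  have hsq : Real.exp (-(r + s)) ^ 2 ≤ Real.exp (-r) ^ 2 := by
    gcongr
    linarith
  have hmono : (3 + Real.exp (-r) ^ 2) * (1 - Real.exp (-r) ^ 2) ≤
      (3 + Real.exp (-(r + s)) ^ 2) * (1 - Real.exp (-(r + s)) ^ 2) := by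
    nlinarith [sq_nonneg (Real.exp (-r)), sq_nonneg (Real.exp (-(r + s)))]
  linarith [mul_le_mul_of_nonneg_left hmono ha]

/-- for `0 < z ≤ w`, with `r = arsinh(1/sinh(z/2))` and
`s = arsinh(1/sinh(w/2))`, one has `a(r+s) u(z) v(w) ≤ 4/(3π)`; equivalently
`a(r+s) u(z) v(w) sinh(z/2) sinh²(w/2) ≤ (4/(3π)) sinh(z/2) sinh²(w/2)`. -/
theorem stmt4 (z w : ℝ) (hz : 0 < z) (hzw : z ≤ w)
    (r s : ℝ) (hr : r = Real.arsinh (1 / Real.sinh (z / 2)))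
    (hs : s = Real.arsinh (1 / Real.sinh (w / 2))) :
    aFun (r + s) * uFun z * vFun w ≤ 4 / (3 * Real.pi) ∧
      aFun (r + s) * uFun z * vFun w * (Real.sinh (z / 2) * Real.sinh (w / 2) ^ 2) ≤
        4 / (3 * Real.pi) * (Real.sinh (z / 2) * Real.sinh (w / 2) ^ 2) := by
  have hw : 0 < w := hz.trans_le hzw
  have hs0 : 0 < Real.sinh (w / 2) := Real.sinh_pos_iff.2 (by linarith)
  have hz0 : 0 < Real.sinh (z / 2) := Real.sinh_pos_iff.2 (by linarith)
  have hmain : aFun (r + s) * uFun z * vFun w ≤ 4 / (3 * Real.pi) := by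
    have hs' : 0 ≤ s := hs ▸ Real.arsinh_nonneg_iff.2 (one_div_pos.2 hs0).le
    calc aFun (r + s) * uFun z * vFun w ≤ 2 / 3 * vFun w :=
          mul_le_mul_of_nonneg_right (hr ▸ aFun_mul_uFun_le hz hs') (vFun_nonneg hw)
      _ ≤ 2 / 3 * (2 / Real.pi) := by gcongr; exact vFun_le hw
      _ = 4 / (3 * Real.pi) := by ring
  exact ⟨hmain, mul_le_mul_of_nonneg_right hmain (by positivity)⟩
end

section
/- For every $t > 0$, $\frac{1}{6} + \frac{4}{9t}\big(1 - e^{-t}\big)^3 \;\le\; \frac{1}{3};$ equivalently, $(1-e^{-t})^3 \le \tfrac{3t}{8}$ for all $t > 0$. -/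
/-- for every `t > 0`, `1/6 + (4/(9t))(1 - e^{-t})³ ≤ 1/3`;
equivalently `(1 - e^{-t})³ ≤ 3t/8`. -/
theorem stmt9 (t : ℝ) (ht : 0 < t) :
    1 / 6 + 4 / (9 * t) * (1 - Real.exp (-t)) ^ 3 ≤ 1 / 3 ∧
      (1 - Real.exp (-t)) ^ 3 ≤ 3 * t / 8 := by
  have key : (1 - Real.exp (-t)) ^ 3 ≤ 3 * t / 8 := by
    -- `exp (-t)` lies above its tangent lines at `t = 0, 1, 2`.
    have h0 : 1 - t ≤ Real.exp (-t) := by linarith [Real.add_one_le_exp (-t)]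
    have h1 : 2 - t ≤ Real.exp 1 * Real.exp (-t) := by
      rw [← Real.exp_add]
      linarith [Real.add_one_le_exp (1 + -t)]
    have h2 : 3 - t ≤ Real.exp 1 * Real.exp 1 * Real.exp (-t) := by
      rw [← Real.exp_add, ← Real.exp_add]
      linarith [Real.add_one_le_exp (1 + 1 + -t)]
    have he : Real.exp 1 ≤ 2.7183 := by linarith [Real.exp_one_lt_d9]
    have hee : Real.exp 1 * Real.exp 1 ≤ 7.39 := by nlinarith [Real.exp_pos 1]
    have hy : 0 < Real.exp (-t) := Real.exp_pos _
    have hy1 : Real.exp (-t) < 1 := by simpa using ht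
    replace h1 := h1.trans (mul_le_mul_of_nonneg_right he hy.le)
    replace h2 := h2.trans (mul_le_mul_of_nonneg_right hee hy.le)
    generalize Real.exp (-t) = y at *
    rcases le_total y 0.22 with h | h
    · nlinarith [mul_nonneg hy.le (sub_nonneg.2 h), pow_pos hy 3]
    rcases le_total y 0.4 with h' | h'
    · have hq : (1 - y) ^ 2 ≤ 1.38 * (1 - y) - 0.468 := by
        nlinarith [mul_nonneg (sub_nonneg.2 h) (sub_nonneg.2 h')]
      nlinarith [mul_le_mul_of_nonneg_left hq (sub_nonneg.2 hy1.le)]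
    · have hq : (1 - y) ^ 2 ≤ 3 / 8 := by nlinarith
      nlinarith [mul_le_mul_of_nonneg_left hq (sub_nonneg.2 hy1.le)]
  refine ⟨?_, key⟩
  have h : 4 / (9 * t) * (1 - Real.exp (-t)) ^ 3 ≤ 4 / (9 * t) * (3 * t / 8) := by gcongr
  have h' : 4 / (9 * t) * (3 * t / 8) = 1 / 6 := by field_simp; norm_num
  linarith
end

section
/- Let $E$ be a real inner product space, let $f : E \to \mathbb{R}$ be continuously differentiable, and let $L : \mathbb{R} \to (0,\infty)$ be continuous with $L(f(p)) \le \|\nabla f(p)\|$ for all $p \in E$. Suppose $x : [a,b] \to E$ is differentiable with $x'(t) = \nabla f(x(t))$ for all $t \in [a,b]$. Then $f(x(a)) \le f(x(b))$ and $\|x(b) - x(a)\| \;\le\; \int_{f(x(a))}^{f(x(b))} \frac{ds}{L(s)}.$ -/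
/-- Along an integral curve of the gradient, `f` grows at rate `‖∇f‖ ^ 2`. -/
theorem hasDerivAt_comp_of_hasDerivAt_gradient {E : Type*} [NormedAddCommGroup E]
    [InnerProductSpace ℝ E] [CompleteSpace E] {f : E → ℝ} {x : ℝ → E} {t : ℝ}
    (hf : DifferentiableAt ℝ f (x t)) (hx : HasDerivAt x (gradient f (x t)) t) :
    HasDerivAt (fun s => f (x s)) (‖gradient f (x t)‖ ^ 2) t := by
  have h := hf.hasGradientAt.hasFDerivAt.comp_hasDerivAt t hx
  rwa [InnerProductSpace.toDual_apply_apply, real_inner_self_eq_norm_sq] at h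

/-- if `f : E → ℝ` is `C¹` on a real inner product space, `L` is a
continuous positive function with `L (f p) ≤ ‖∇f(p)‖` for all `p`, and
`x : [a,b] → E` is an integral curve of `∇f`, then `f(x a) ≤ f(x b)` and
`‖x b - x a‖ ≤ ∫_{f(x a)}^{f(x b)} ds / L s`. -/
theorem stmt11 {E : Type*} [NormedAddCommGroup E] [InnerProductSpace ℝ E] [CompleteSpace E]
    (f : E → ℝ) (hf : ContDiff ℝ 1 f)
    (L : ℝ → ℝ) (hLpos : ∀ s, 0 < L s) (hLcont : Continuous L)
    (hL : ∀ p, L (f p) ≤ ‖gradient f p‖)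
    (a b : ℝ) (hab : a ≤ b) (x : ℝ → E)
    (hx : ∀ t ∈ Set.Icc a b, HasDerivAt x (gradient f (x t)) t) :
    f (x a) ≤ f (x b) ∧ ‖x b - x a‖ ≤ ∫ s in (f (x a))..(f (x b)), 1 / L s := by
  have hfx : ∀ t ∈ Set.Icc a b, HasDerivAt (fun s => f (x s)) (‖gradient f (x t)‖ ^ 2) t :=
    fun t ht => hasDerivAt_comp_of_hasDerivAt_gradient (hf.differentiable one_ne_zero _) (hx t ht)
  have hmono : MonotoneOn (fun s => f (x s)) (Set.Icc a b) :=
    monotoneOn_of_hasDerivWithinAt_nonneg (convex_Icc a b)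
      (fun t ht => (hfx t ht).continuousAt.continuousWithinAt)
      (fun t ht => (hfx t (interior_subset ht)).hasDerivWithinAt) (fun t _ => sq_nonneg _)
  refine ⟨hmono (Set.left_mem_Icc.2 hab) (Set.right_mem_Icc.2 hab) hab, ?_⟩
  have hcont : Continuous fun s => 1 / L s := continuous_const.div hLcont fun s => (hLpos s).ne'
  have hB : ∀ t ∈ Set.Icc a b, HasDerivAt (fun t => ∫ s in (f (x a))..(f (x t)), 1 / L s)
      (1 / L (f (x t)) * ‖gradient f (x t)‖ ^ 2) t := fun t ht =>
    HasDerivAt.comp (h₂ := fun u => ∫ s in (f (x a))..u, 1 / L s) t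
      (hcont.integral_hasStrictDerivAt (f (x a)) (f (x t))).hasDerivAt (hfx t ht)
  refine image_norm_le_of_norm_deriv_right_le_deriv_boundary' (f := fun t => x t - x a)
    (fun t ht => ((hx t ht).sub_const (x a)).continuousAt.continuousWithinAt)
    (fun t ht => ((hx t (Set.Ico_subset_Icc_self ht)).sub_const (x a)).hasDerivWithinAt)
    (by simp) (fun t ht => (hB t ht).continuousAt.continuousWithinAt)
    (fun t ht => (hB t (Set.Ico_subset_Icc_self ht)).hasDerivWithinAt)
    (fun t _ => ?_) (Set.right_mem_Icc.2 hab)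
  rw [one_div_mul_eq_div, le_div_iff₀ (hLpos _), sq]
  exact mul_le_mul_of_nonneg_left (hL _) (norm_nonneg _)
end

section
/- Let $E$ be a real inner product space, let $f : E \to \mathbb{R}$ be continuously differentiable, and let $U : \mathbb{R} \to (0,\infty)$ be continuous with $\|\nabla f(p)\| \le U(f(p))$ for all $p \in E$. Then for any $x, y \in E$ with $f(x) \le f(y)$, $\|x - y\| \;\ge\; \int_{f(x)}^{f(y)} \frac{ds}{U(s)}.$ -/
/-- if `f : E → ℝ` is `C¹` on a real inner product space and `U` is a
continuous positive function with `‖∇f(p)‖ ≤ U (f p)` for all `p`, then for all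
`x, y` with `f x ≤ f y`, `‖x - y‖ ≥ ∫_{f x}^{f y} ds / U s`. -/
theorem stmt12 {E : Type*} [NormedAddCommGroup E] [InnerProductSpace ℝ E] [CompleteSpace E]
    (f : E → ℝ) (hf : ContDiff ℝ 1 f)
    (U : ℝ → ℝ) (hUpos : ∀ s, 0 < U s) (hUcont : Continuous U)
    (hU : ∀ p, ‖gradient f p‖ ≤ U (f p))
    (x y : E) (hxy : f x ≤ f y) :
    (∫ s in (f x)..(f y), 1 / U s) ≤ ‖x - y‖ := by
  have hcont : Continuous fun s => 1 / U s :=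
    continuous_const.div hUcont fun s => (hUpos s).ne'
  have hderiv : ∀ p ∈ (Set.univ : Set E),
      HasFDerivWithinAt (fun q => ∫ s in (f x)..(f q), 1 / U s)
        ((1 / U (f p)) • fderiv ℝ f p) Set.univ p := fun p _ =>
    ((intervalIntegral.integral_hasDerivAt_right (hcont.intervalIntegrable _ _)
      (hcont.stronglyMeasurableAtFilter _ _) hcont.continuousAt).comp_hasFDerivAt p
        (hf.differentiable one_ne_zero p).hasFDerivAt).hasFDerivWithinAt
  have hbound : ∀ p ∈ (Set.univ : Set E), ‖(1 / U (f p)) • fderiv ℝ f p‖ ≤ 1 := by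
    intro p _
    have hp : ‖fderiv ℝ f p‖ ≤ U (f p) := by
      simpa [gradient] using hU p
    rw [norm_smul, Real.norm_of_nonneg (one_div_pos.2 (hUpos _)).le, one_div_mul_eq_div]
    exact (div_le_one (hUpos _)).2 hp
  have hmvt := convex_univ.norm_image_sub_le_of_norm_hasFDerivWithin_le hderiv hbound
    (Set.mem_univ x) (Set.mem_univ y)
  rw [intervalIntegral.integral_same, sub_zero, one_mul, norm_sub_rev] at hmvt
  exact (le_abs_self _).trans hmvt
end

section
/- Let $E$ be a real inner product space, let $f_1, \dots, f_n : E \to \mathbb{R}$ be continuously differentiable functions, and set $f(p) = \min_{1 \le i \le n} f_i(p)$. Let $U : \mathbb{R} \to (0,\infty)$ be continuous and suppose that for every $p \in E$ and every index $i$ with $f_i(p) = f(p)$ one has $\|\nabla f_i(p)\| \le U(f(p))$. Then for any $x, y \in E$, $\|x - y\| \;\ge\; \Big|\int_{f(x)}^{f(y)} \frac{ds}{U(s)}\Big|.$ -/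
/-- A continuous function on `E` that is touched from above at every point by a function whose
derivative there has norm at most `C` satisfies a one-sided `C`-Lipschitz estimate. -/
theorem sub_le_mul_norm_sub_of_touching {E : Type*} [NormedAddCommGroup E] [NormedSpace ℝ E]
    {h : E → ℝ} (hcont : Continuous h) {C : ℝ}
    (htouch : ∀ p, ∃ (g : E → ℝ) (g' : E →L[ℝ] ℝ),
      HasFDerivAt g g' p ∧ g p = h p ∧ (∀ q, h q ≤ g q) ∧ ‖g'‖ ≤ C) (x y : E) :
    h y - h x ≤ C * ‖y - x‖ := by
  let γ : ℝ → E := fun t => x + t • (y - x)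
  have hγ : ∀ t, HasDerivAt γ (y - x) t := fun t => by
    simpa only [one_smul] using! ((hasDerivAt_id t).smul_const (y - x)).const_add x
  have hγcont : Continuous γ := continuous_iff_continuousAt.2 fun t => (hγ t).continuousAt
  have key := image_le_of_liminf_slope_right_le_deriv_boundary
    (f := fun t => h (γ t)) (a := 0) (b := 1) (hcont.comp hγcont).continuousOn
    (B := fun t => h x + t * (C * ‖y - x‖)) (B' := fun _ => C * ‖y - x‖)
    (by simp [γ]) (by fun_prop)
    (fun t _ => by
      simpa using (((hasDerivAt_id t).mul_const (C * ‖y - x‖)).const_add (h x)).hasDerivWithinAt)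
    (fun t _ r hr => by
      obtain ⟨g, g', hg, hgp, hle, hC⟩ := htouch (γ t)
      have hderiv := (hg.comp_hasDerivAt t (hγ t)).hasDerivWithinAt (s := Set.Ioi t)
      have hlt : g' (y - x) < r :=
        ((le_abs_self _).trans (g'.le_of_opNorm_le hC _)).trans_lt hr
      have hslope := (hasDerivWithinAt_iff_tendsto_slope' (by simp)).1 hderiv
      refine Filter.Eventually.frequently ?_
      filter_upwards [hslope.eventually (gt_mem_nhds hlt), self_mem_nhdsWithin] with z hz htz
      refine lt_of_le_of_lt ?_ hz
      have htz' : 0 < z - t := sub_pos.2 htz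
      simp only [slope_def_field, Function.comp_apply, hgp]
      gcongr
      exact hle _)
  have := key (Set.right_mem_Icc.2 zero_le_one)
  simp only [γ, one_smul, add_sub_cancel, one_mul] at this
  linarith

/-- A finite infimum of continuous functions is continuous. -/
theorem continuous_ciInf_of_finite {X ι : Type*} [TopologicalSpace X] [Finite ι] [Nonempty ι]
    {F : ι → X → ℝ} (hF : ∀ i, Continuous (F i)) : Continuous fun p => ⨅ i, F i p := by
  cases nonempty_fintype ι
  simp only [← Finset.inf'_univ_eq_ciInf]
  exact Continuous.finset_inf'_apply _ fun i _ => hF i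

/-- let `F 0, …, F n : E → ℝ` be `C¹` on a real inner product space and
`f p = min_i F i p`. If `U` is continuous and positive and `‖∇(F i)(p)‖ ≤ U (f p)`
whenever `F i p = f p`, then `‖x - y‖ ≥ |∫_{f x}^{f y} ds / U s|` for all `x, y`. -/
theorem stmt13 {E : Type*} [NormedAddCommGroup E] [InnerProductSpace ℝ E] [CompleteSpace E]
    (n : ℕ) (F : Fin (n + 1) → E → ℝ) (hF : ∀ i, ContDiff ℝ 1 (F i))
    (f : E → ℝ) (hf : ∀ p, f p = ⨅ i, F i p)
    (U : ℝ → ℝ) (hUpos : ∀ s, 0 < U s) (hUcont : Continuous U)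
    (hU : ∀ p, ∀ i, F i p = f p → ‖gradient (F i) p‖ ≤ U (f p))
    (x y : E) :
    |∫ s in (f x)..(f y), 1 / U s| ≤ ‖x - y‖ := by
  have hV : Continuous fun s => 1 / U s := continuous_const.div hUcont fun s => (hUpos s).ne'
  let G : ℝ → ℝ := fun u => ∫ s in (0 : ℝ)..u, 1 / U s
  have hG : ∀ u, HasDerivAt G (1 / U u) u := fun u =>
    hV.integral_hasStrictDerivAt 0 u |>.hasDerivAt
  have hGmono : Monotone G := monotone_of_deriv_nonneg (fun u => (hG u).differentiableAt)
    fun u => by rw [(hG u).deriv]; exact (one_div_pos.2 (hUpos u)).le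
  have hGcont : Continuous G := continuous_iff_continuousAt.2 fun u => (hG u).continuousAt
  have hfcont : Continuous f := by
    rw [funext hf]
    exact continuous_ciInf_of_finite fun i => (hF i).continuous
  have htouch : ∀ p, ∃ (g : E → ℝ) (g' : E →L[ℝ] ℝ),
      HasFDerivAt g g' p ∧ g p = G (f p) ∧ (∀ q, G (f q) ≤ g q) ∧ ‖g'‖ ≤ 1 := fun p => by
    obtain ⟨i, hi⟩ := exists_eq_ciInf_of_finite (f := fun i => F i p)
    rw [← hf p] at hi
    have hFi : HasFDerivAt (F i) (fderiv ℝ (F i) p) p :=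
      ((hF i).differentiable one_ne_zero p).hasFDerivAt
    refine ⟨fun q => G (F i q), _, (hG (F i p)).comp_hasFDerivAt p hFi, congrArg G hi,
      fun q => hGmono ?_, ?_⟩
    · rw [hf q]
      exact ciInf_le (Set.finite_range _).bddBelow i
    · have hgrad := hU p i hi
      rw [gradient, LinearIsometryEquiv.norm_map] at hgrad
      rw [norm_smul, hi, Real.norm_of_nonneg (one_div_pos.2 (hUpos _)).le, one_div_mul_eq_div]
      exact (div_le_one (hUpos _)).2 hgrad
  have hLip := sub_le_mul_norm_sub_of_touching (hGcont.comp hfcont) htouch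
  have hint : ∫ s in (f x)..(f y), 1 / U s = G (f y) - G (f x) :=
    (intervalIntegral.integral_interval_sub_left (hV.intervalIntegrable _ _)
      (hV.intervalIntegrable _ _)).symm
  rw [hint, abs_sub_le_iff]
  exact ⟨by simpa [norm_sub_rev] using hLip x y, by simpa using hLip y x⟩
end

section
/- Let $a < T$ be real numbers, let $C > 0$, and let $f, g : (a, T] \to (0,\infty)$ be differentiable functions satisfying $f'(t) \ge \tfrac{2}{\pi} f(t)$ and $0 \le g'(t) \le C\, f(t)^2 g(t)^2$ for all $t \in (a,T]$. If $\inf_{t \in (a,T]} f(t) > 0$, then $\inf_{t \in (a,T]} g(t) > 0$; equivalently, $\lim_{t \to a^+} g(t) > 0$. -/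
/-- A function with nonnegative derivative within a convex set is monotone on it. -/
theorem Convex.monotoneOn_of_hasDerivWithinAt_self {D : Set ℝ} (hD : Convex ℝ D) {f f' : ℝ → ℝ}
    (hf : ∀ t ∈ D, HasDerivWithinAt f (f' t) D t) (hf' : ∀ t ∈ D, 0 ≤ f' t) :
    MonotoneOn f D :=
  monotoneOn_of_hasDerivWithinAt_nonneg hD (fun t ht => (hf t ht).continuousWithinAt)
    (fun t ht => (hf t (interior_subset ht)).mono interior_subset)
    (fun t ht => hf' t (interior_subset ht))

/-- If `g > 0` and `g' ≤ K g²` on a convex set, then `1 / g` decreases at rate at most `K`. -/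
theorem Convex.monotoneOn_inv_add_mul {D : Set ℝ} (hD : Convex ℝ D) {g g' : ℝ → ℝ} {K : ℝ}
    (hpos : ∀ t ∈ D, 0 < g t) (hg : ∀ t ∈ D, HasDerivWithinAt g (g' t) D t)
    (hg' : ∀ t ∈ D, g' t ≤ K * g t ^ 2) :
    MonotoneOn (fun t => (g t)⁻¹ + K * t) D := by
  refine hD.monotoneOn_of_hasDerivWithinAt_self (f' := fun t => -g' t / g t ^ 2 + K * 1)
    (fun t ht => ((hg t ht).fun_inv (hpos t ht).ne').add
      ((hasDerivWithinAt_id t D).const_mul K)) fun t ht => ?_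
  have h : g' t / g t ^ 2 ≤ K := (div_le_iff₀ (pow_pos (hpos t ht) 2)).2 (hg' t ht)
  rw [neg_div]
  linarith

/-- let `a < T`, `C > 0`, and `f, g : (a,T] → (0,∞)` be differentiable
with `f' ≥ (2/π) f` and `0 ≤ g' ≤ C f² g²` on `(a,T]`. If `inf f > 0` on `(a,T]`
then `inf g > 0` on `(a,T]`. -/
theorem stmt14 (a T : ℝ) (haT : a < T) (C : ℝ) (hC : 0 < C)
    (f g f' g' : ℝ → ℝ)
    (hfpos : ∀ t ∈ Set.Ioc a T, 0 < f t) (hgpos : ∀ t ∈ Set.Ioc a T, 0 < g t)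
    (hf : ∀ t ∈ Set.Ioc a T, HasDerivWithinAt f (f' t) (Set.Ioc a T) t)
    (hg : ∀ t ∈ Set.Ioc a T, HasDerivWithinAt g (g' t) (Set.Ioc a T) t)
    (hf' : ∀ t ∈ Set.Ioc a T, 2 / Real.pi * f t ≤ f' t)
    (hg' : ∀ t ∈ Set.Ioc a T, 0 ≤ g' t ∧ g' t ≤ C * f t ^ 2 * g t ^ 2)
    (hinf : 0 < ⨅ t : Set.Ioc a T, f t) :
    0 < ⨅ t : Set.Ioc a T, g t := by
  have hT : T ∈ Set.Ioc a T := Set.right_mem_Ioc.2 haT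
  have hfmono : MonotoneOn f (Set.Ioc a T) :=
    (convex_Ioc a T).monotoneOn_of_hasDerivWithinAt_self hf fun t ht =>
      (mul_pos (by positivity) (hfpos t ht)).le.trans (hf' t ht)
  have hmono : MonotoneOn (fun t => (g t)⁻¹ + C * f T ^ 2 * t) (Set.Ioc a T) := by
    refine (convex_Ioc a T).monotoneOn_inv_add_mul hgpos hg fun t ht => (hg' t ht).2.trans ?_
    have := hfmono ht hT ht.2
    have := (hfpos t ht).le
    gcongr
  have hK : 0 ≤ C * f T ^ 2 := by positivity
  have hB : 0 < (g T)⁻¹ + C * f T ^ 2 * (T - a) :=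
    add_pos_of_pos_of_nonneg (inv_pos.2 (hgpos T hT)) (mul_nonneg hK (sub_pos.2 haT).le)
  have : Nonempty (Set.Ioc a T) := ⟨⟨T, hT⟩⟩
  refine (inv_pos.2 hB).trans_le (le_ciInf fun ⟨t, ht⟩ => ?_)
  refine inv_le_of_inv_le₀ (hgpos t ht) ?_
  have h1 : (g t)⁻¹ + C * f T ^ 2 * t ≤ (g T)⁻¹ + C * f T ^ 2 * T := hmono ht hT ht.2
  have h2 : C * f T ^ 2 * a ≤ C * f T ^ 2 * t := mul_le_mul_of_nonneg_left ht.1.le hK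
  linarith
end
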